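/- arXiv:1211.4424 — 6 statements merged into one kernel-verified Lean document; each statement's English description precedes it below -/
import Mathlib

section
/- (Analytical continuation formula for left factorization.) For every word w, Q⁺ w = Q⁺ (w⁺⁻) * (G (w⁺⁻))⁻¹ * G (w⁺), where w⁺⁻ denotes (w⁺)⁻. -/
/-- `truncPlus w` is `w⁺`: the word `w` with its maximal prefix of a-letters removed. -/
def truncPlus {α β : Type*} (w : List (α ⊕ β)) : List (α ⊕ β) :=
  w.dropWhile Sum.isLeft

/-- `truncMinus w` is `w⁻`: the word `w` with its maximal prefix of b-letters removed. -/
def truncMinus {α β : Type*} (w : List (α ⊕ β)) : List (α ⊕ β) :=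
  w.dropWhile Sum.isRight

/-- Analytical continuation formula for left factorization `G = Q⁻ Q⁺`:
`Q⁺ w = Q⁺ (w⁺⁻) * (G (w⁺⁻))⁻¹ * G (w⁺)`. -/
theorem analytic_continuation_left_factorization {α β : Type*} {N : ℕ} (hN : 1 ≤ N)
    (G Qp Qm : List (α ⊕ β) → Matrix (Fin N) (Fin N) ℂ)
    (hG : ∀ w, IsUnit (G w)) (hQp : ∀ w, IsUnit (Qp w)) (hQm : ∀ w, IsUnit (Qm w))
    (hfact : ∀ w, G w = Qm w * Qp w)
    (hQpReg : ∀ w, Qp w = Qp (truncPlus w))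
    (hQmReg : ∀ w, Qm w = Qm (truncMinus w)) :
    ∀ w, Qp w =
      Qp (truncMinus (truncPlus w)) * (G (truncMinus (truncPlus w)))⁻¹ * G (truncPlus w) := by
  intro w
  have hp := (Matrix.isUnit_iff_isUnit_det _).mp (hQp (truncMinus (truncPlus w)))
  have hm := (Matrix.isUnit_iff_isUnit_det _).mp (hQm (truncMinus (truncPlus w)))
  rw [hfact (truncMinus (truncPlus w)), hfact (truncPlus w), hQmReg (truncPlus w),
    ← hQpReg w, Matrix.mul_inv_rev, Matrix.mul_nonsing_inv_cancel_left _ _ hp,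
    Matrix.nonsing_inv_mul_cancel_left _ _ hm]
end

section
/- If G is balanced, then for every word w the matrices G w and Q⁺ e commute. -/
/-- `W_a`: the set of words consisting only of a-letters. -/
def Wa (α β : Type*) : Set (List (α ⊕ β)) := {w | ∀ x ∈ w, x.isLeft}

/-- `W_b`: the set of words consisting only of b-letters. -/
def Wb (α β : Type*) : Set (List (α ⊕ β)) := {w | ∀ x ∈ w, x.isRight}

/-- `G` is balanced if each of its sheets can be reached by a word of `W_a`
and by a word of `W_b`. -/
def IsBalanced {α β : Type*} {N : ℕ} (G : List (α ⊕ β) → Matrix (Fin N) (Fin N) ℂ) : Prop :=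
  ∀ w, ∃ wa ∈ Wa α β, ∃ wb ∈ Wb α β, G wa = G w ∧ G wb = G w

/-- Truncating a word of `W_a` leaves the empty word. -/
theorem truncPlus_eq_nil_of_mem_Wa {α β : Type*} {w : List (α ⊕ β)} (hw : w ∈ Wa α β) :
    truncPlus w = [] :=
  List.dropWhile_eq_nil_iff.mpr hw

/-- If `G` is balanced, then for every word `w` the matrices `G w` and `Q⁺ e` commute. -/
theorem commute_G_Qplus_of_balanced {α β : Type*} {N : ℕ} (hN : 1 ≤ N)
    (G Qp Qm : List (α ⊕ β) → Matrix (Fin N) (Fin N) ℂ)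
    (hG : ∀ w, IsUnit (G w)) (hQp : ∀ w, IsUnit (Qp w)) (hQm : ∀ w, IsUnit (Qm w))
    (hfact₁ : ∀ w, Qp w * Qm w = G w) (hfact₂ : ∀ w, Qm w * Qp w = G w)
    (hQpReg : ∀ w, Qp w = Qp (truncPlus w))
    (hQmReg : ∀ w, Qm w = Qm (truncMinus w))
    (hbal : IsBalanced G) :
    ∀ w, Commute (G w) (Qp []) := by
  intro w
  obtain ⟨wa, hwa, -, -, hGwa, -⟩ := hbal w
  have hQ : Qp wa = Qp [] := by rw [hQpReg, truncPlus_eq_nil_of_mem_Wa hwa]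
  have hcomm : Commute (Qp wa) (Qm wa) := (hfact₁ wa).trans (hfact₂ wa).symm
  rw [← hGwa, ← hfact₁, ← hQ]
  exact (Commute.refl _).mul_left hcomm.symm
end

section
/- If G is balanced, then for every word v₁ consisting only of b-letters (v₁ ∈ W_b) and every word v₂ consisting only of a-letters (v₂ ∈ W_a), the matrices G (v₁ ++ v₂) and G v₂ commute. -/
theorem truncPlus_of_mem_Wa {α β : Type*} {v : List (α ⊕ β)} (hv : v ∈ Wa α β) :
    truncPlus v = [] :=
  List.dropWhile_eq_nil_iff.2 hv

theorem truncMinus_append_of_mem_Wb {α β : Type*} {v : List (α ⊕ β)} (hv : v ∈ Wb α β)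
    (w : List (α ⊕ β)) : truncMinus (v ++ w) = truncMinus w :=
  List.dropWhile_append_of_pos hv

/-- If `G` is balanced, then for every `v₁ ∈ W_b` and `v₂ ∈ W_a`, the matrices
`G (v₁ ++ v₂)` and `G v₂` commute. -/
theorem commute_G_append_of_balanced {α β : Type*} {N : ℕ} (hN : 1 ≤ N)
    (G Qp Qm : List (α ⊕ β) → Matrix (Fin N) (Fin N) ℂ)
    (hG : ∀ w, IsUnit (G w)) (hQp : ∀ w, IsUnit (Qp w)) (hQm : ∀ w, IsUnit (Qm w))
    (hfact₁ : ∀ w, Qp w * Qm w = G w) (hfact₂ : ∀ w, Qm w * Qp w = G w)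
    (hQpReg : ∀ w, Qp w = Qp (truncPlus w))
    (hQmReg : ∀ w, Qm w = Qm (truncMinus w))
    (hbal : IsBalanced G) :
    ∀ v₁ ∈ Wb α β, ∀ v₂ ∈ Wa α β, Commute (G (v₁ ++ v₂)) (G v₂) := by
  intro v₁ hv₁ v₂ hv₂
  have hQp_nil : ∀ v ∈ Wa α β, Qp v = Qp [] := fun v hv => by
    rw [hQpReg, truncPlus_of_mem_Wa hv]
  have hQm_append : Qm (v₁ ++ v₂) = Qm v₂ := by
    rw [hQmReg, truncMinus_append_of_mem_Wb hv₁, ← hQmReg]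
  have hcomm (w) : Commute (Qp w) (Qm w) := (hfact₁ w).trans (hfact₂ w).symm
  have hP (w) : Commute (G w) (Qp []) := by
    obtain ⟨wa, hwa, -, -, hw, -⟩ := hbal w
    rw [← hw, ← hfact₁, ← hQp_nil wa hwa]
    exact (Commute.refl _).mul_left (hcomm wa).symm
  have hM : Commute (G (v₁ ++ v₂)) (Qm v₂) := by
    rw [← hfact₁, ← hQm_append]
    exact (hcomm _).mul_left (Commute.refl _)
  rw [← hfact₁ v₂, hQp_nil v₂ hv₂]
  exact (hP _).mul_right hM
end

section
/- (Core of Hurd reduction.) Let G₁, …, G_n be invertible N×N complex matrices and f₁, …, f_n complex scalars. Suppose the bypass matrices G_i * G₁⁻¹ pairwise commute. Set S = ∑_{j=1}^n f_j • G_j⁻¹. Then the matrices H_i = G_i * S, i = 1, …, n, pairwise commute. -/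
/-- A matrix commuting with `B` commutes with `B⁻¹`. -/
theorem Matrix.commute_inv_right {m R : Type*} [Fintype m] [DecidableEq m] [CommRing R]
    {A B : Matrix m m R} (h : Commute A B) : Commute A B⁻¹ := by
  simpa using Matrix.Commute.zpow_right h (-1)

/-- If the matrices `G i * A⁻¹` pairwise commute for an invertible `A`, then so do the matrices
`G i * ∑ j, f j • (G j)⁻¹`. -/
theorem Matrix.commute_mul_sum_smul_inv {ι m R : Type*} [Fintype ι] [Fintype m] [DecidableEq m]
    [CommRing R] {G : ι → Matrix m m R} {A : Matrix m m R} (hA : IsUnit A.det) (f : ι → R)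
    (h : ∀ i j, Commute (G i * A⁻¹) (G j * A⁻¹)) (i j : ι) :
    Commute (G i * ∑ k, f k • (G k)⁻¹) (G j * ∑ k, f k • (G k)⁻¹) := by
  have hS (i : ι) : G i * ∑ k, f k • (G k)⁻¹ =
      G i * A⁻¹ * ∑ k, f k • (G k * A⁻¹)⁻¹ := by
    simp only [Matrix.mul_inv_rev, Matrix.nonsing_inv_nonsing_inv A hA, ← Matrix.mul_smul,
      ← Finset.mul_sum, ← Matrix.mul_assoc, Matrix.nonsing_inv_mul_cancel_right A (G i) hA]
  have hT (i : ι) : Commute (G i * A⁻¹) (∑ k, f k • (G k * A⁻¹)⁻¹) :=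
    Commute.sum_right _ _ _ fun k _ => (Matrix.commute_inv_right (h i k)).smul_right (f k)
  rw [hS i, hS j]
  exact ((h i j).mul_right (hT i)).mul_left ((hT j).symm.mul_right (Commute.refl _))

/-- Core of Hurd reduction: if the bypass matrices `G i * (G 0)⁻¹` pairwise commute and
`S = ∑ j, f j • (G j)⁻¹`, then the matrices `G i * S` pairwise commute. -/
theorem hurd_reduction {N n : ℕ} (hn : 1 ≤ n)
    (G : Fin n → Matrix (Fin N) (Fin N) ℂ) (hG : ∀ i, IsUnit (G i))
    (f : Fin n → ℂ)
    (hbasic : ∀ i j : Fin n, Commute (G i * (G ⟨0, hn⟩)⁻¹) (G j * (G ⟨0, hn⟩)⁻¹))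
    (S : Matrix (Fin N) (Fin N) ℂ) (hS : S = ∑ j : Fin n, f j • (G j)⁻¹) :
    ∀ i j : Fin n, Commute (G i * S) (G j * S) := by
  subst hS
  exact Matrix.commute_mul_sum_smul_inv ((Matrix.isUnit_iff_isUnit_det _).mp (hG _)) f hbasic
end

section
/- (Converse of Hurd reduction.) Let G₁, …, G_n be invertible N×N complex matrices. If there exists an invertible N×N complex matrix S such that the matrices G_i * S pairwise commute, then all bypass matrices pairwise commute: for all indices i, j, k, l, the matrices G_i * G_j⁻¹ and G_k * G_l⁻¹ commute. -/
/-- In a group, if the elements `g i * s` pairwise commute, then so do all the quotients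
`g i * (g j)⁻¹`. -/
theorem commute_mul_inv_of_commute_mul_right {ι H : Type*} [Group H] (g : ι → H) (s : H)
    (h : ∀ i j, Commute (g i * s) (g j * s)) (i j k l : ι) :
    Commute (g i * (g j)⁻¹) (g k * (g l)⁻¹) := by
  have key : ∀ a b, g a * (g b)⁻¹ = (g a * s) * (g b * s)⁻¹ := fun a b => by group
  rw [key i j, key k l]
  exact ((h i k).mul_right (h i l).inv_right).mul_left
    ((h j k).inv_left.mul_right (h j l).inv_inv)

/-- Converse of Hurd reduction: if some invertible `S` makes all `G i * S` pairwise
commute, then all bypass matrices `G i * (G j)⁻¹` pairwise commute. -/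
theorem hurd_reduction_converse {N n : ℕ}
    (G : Fin n → Matrix (Fin N) (Fin N) ℂ) (hG : ∀ i, IsUnit (G i))
    (hS : ∃ S : Matrix (Fin N) (Fin N) ℂ, IsUnit S ∧
      ∀ i j : Fin n, Commute (G i * S) (G j * S)) :
    ∀ i j k l : Fin n, Commute (G i * (G j)⁻¹) (G k * (G l)⁻¹) := by
  obtain ⟨_, ⟨s, rfl⟩, hcomm⟩ := hS
  choose g hg using hG
  obtain rfl : (fun i => (g i : Matrix (Fin N) (Fin N) ℂ)) = G := funext hg
  intro i j k l
  have h := commute_mul_inv_of_commute_mul_right g s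
    (fun a b => Units.ext (by simpa using (hcomm a b).eq)) i j k l
  simpa only [Units.val_mul, Matrix.coe_units_inv] using h.units_val
end

section
/- (Uniqueness of factorization up to an entire factor.) Let ε > 0, let U = {z ∈ ℂ : Im z > -ε} and L = {z ∈ ℂ : Im z < ε}. Let Q₁⁺, Q₂⁺ : ℂ → Matrix N N ℂ be analytic on U, let Q₁⁻, Q₂⁻ : ℂ → Matrix N N ℂ be analytic on L, and suppose all values Q₁⁺(k), Q₂⁺(k) for k ∈ U and Q₁⁻(k), Q₂⁻(k) for k ∈ L are invertible matrices. If Q₁⁺(k) * Q₁⁻(k) = Q₂⁺(k) * Q₂⁻(k) for all k in the strip U ∩ L, then there exists a function R : ℂ → Matrix N N ℂ analytic on all of ℂ such that R(k) = (Q₁⁺(k))⁻¹ * Q₂⁺(k) for all k ∈ U and R(k) = Q₁⁻(k) * (Q₂⁻(k))⁻¹ for all k ∈ L; in particular Q₂⁺ = Q₁⁺ * R on U and Q₁⁻ = R * Q₂⁻ on L. -/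
open Complex Set

/-- A matrix-valued function is analytic on an open set iff each entry is;
we express analyticity entrywise. -/
def MatAnalyticOn {N : ℕ} (F : ℂ → Matrix (Fin N) (Fin N) ℂ) (s : Set ℂ) : Prop :=
  ∀ i j : Fin N, AnalyticOnNhd ℂ (fun k => F k i j) s

namespace MatAnalyticOn

variable {N : ℕ} {F G : ℂ → Matrix (Fin N) (Fin N) ℂ} {s : Set ℂ}

theorem mul (hF : MatAnalyticOn F s) (hG : MatAnalyticOn G s) :
    MatAnalyticOn (fun k => F k * G k) s := by
  intro i j
  simp only [Matrix.mul_apply]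
  exact Finset.univ.analyticOnNhd_fun_sum fun l _ => (hF i l).mul (hG l j)

theorem det (hF : MatAnalyticOn F s) : AnalyticOnNhd ℂ (fun k => (F k).det) s := by
  simp only [Matrix.det_apply']
  exact Finset.univ.analyticOnNhd_fun_sum fun σ _ =>
    analyticOnNhd_const.mul (Finset.univ.analyticOnNhd_fun_prod fun l _ => hF (σ l) l)

theorem adjugate (hF : MatAnalyticOn F s) : MatAnalyticOn (fun k => (F k).adjugate) s := by
  intro i j
  simp only [Matrix.adjugate_apply]
  refine MatAnalyticOn.det fun a b => ?_
  simp only [Matrix.updateRow_apply]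
  split_ifs
  · exact analyticOnNhd_const
  · exact hF a b

theorem inv (hF : MatAnalyticOn F s) (hu : ∀ k ∈ s, IsUnit (F k)) :
    MatAnalyticOn (fun k => (F k)⁻¹) s := by
  intro i j
  simp only [Matrix.inv_def, Ring.inverse_eq_inv', Matrix.smul_apply, smul_eq_mul]
  exact (hF.det.inv fun k hk => ((Matrix.isUnit_iff_isUnit_det _).1 (hu k hk)).ne_zero).mul
    (hF.adjugate i j)

/-- Analyticity on an open set depends only on the values on that set. -/
theorem congr (hF : MatAnalyticOn F s) (hs : IsOpen s) (h : ∀ k ∈ s, F k = G k) :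
    MatAnalyticOn G s :=
  fun i j => (hF i j).congr hs fun k hk => by simp only [h k hk]

end MatAnalyticOn

/-- Uniqueness of Wiener–Hopf factorization up to an entire factor: two factorizations of
the same matrix function on the strip differ by a matrix function `R` analytic on all of `ℂ`. -/
theorem factorization_unique_up_to_entire {N : ℕ} (hN : 1 ≤ N)
    (ε : ℝ) (hε : 0 < ε)
    (U L : Set ℂ) (hU : U = {z : ℂ | -ε < z.im}) (hL : L = {z : ℂ | z.im < ε})
    (Q₁p Q₂p Q₁m Q₂m : ℂ → Matrix (Fin N) (Fin N) ℂ)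
    (hQ₁p : MatAnalyticOn Q₁p U) (hQ₂p : MatAnalyticOn Q₂p U)
    (hQ₁m : MatAnalyticOn Q₁m L) (hQ₂m : MatAnalyticOn Q₂m L)
    (hQ₁pU : ∀ k ∈ U, IsUnit (Q₁p k)) (hQ₂pU : ∀ k ∈ U, IsUnit (Q₂p k))
    (hQ₁mU : ∀ k ∈ L, IsUnit (Q₁m k)) (hQ₂mU : ∀ k ∈ L, IsUnit (Q₂m k))
    (hfact : ∀ k ∈ U ∩ L, Q₁p k * Q₁m k = Q₂p k * Q₂m k) :
    ∃ R : ℂ → Matrix (Fin N) (Fin N) ℂ,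
      MatAnalyticOn R Set.univ ∧
      (∀ k ∈ U, R k = (Q₁p k)⁻¹ * Q₂p k) ∧
      (∀ k ∈ L, R k = Q₁m k * (Q₂m k)⁻¹) ∧
      (∀ k ∈ U, Q₂p k = Q₁p k * R k) ∧
      (∀ k ∈ L, Q₁m k = R k * Q₂m k) := by
  have hUo : IsOpen U := hU ▸ isOpen_lt continuous_const continuous_im
  have hLo : IsOpen L := hL ▸ isOpen_lt continuous_im continuous_const
  have hcover : ∀ k, k ∈ U ∨ k ∈ L := by
    intro k
    simp only [hU, hL, mem_ofPred_eq]
    by_contra! h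
    linarith
  have detUnit {A : Matrix (Fin N) (Fin N) ℂ} (hA : IsUnit A) : IsUnit A.det :=
    (Matrix.isUnit_iff_isUnit_det A).1 hA
  classical
  let R : ℂ → Matrix (Fin N) (Fin N) ℂ := fun k =>
    if k ∈ U then (Q₁p k)⁻¹ * Q₂p k else Q₁m k * (Q₂m k)⁻¹
  have hRU : ∀ k ∈ U, R k = (Q₁p k)⁻¹ * Q₂p k := fun k hk => if_pos hk
  have hRL : ∀ k ∈ L, R k = Q₁m k * (Q₂m k)⁻¹ := by
    intro k hk
    by_cases hkU : k ∈ U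
    · rw [hRU k hkU]
      calc (Q₁p k)⁻¹ * Q₂p k = (Q₁p k)⁻¹ * (Q₂p k * Q₂m k) * (Q₂m k)⁻¹ := by
            rw [← mul_assoc, Matrix.mul_nonsing_inv_cancel_right _ _ (detUnit (hQ₂mU k hk))]
        _ = Q₁m k * (Q₂m k)⁻¹ := by
            rw [← hfact k ⟨hkU, hk⟩,
              Matrix.nonsing_inv_mul_cancel_left _ _ (detUnit (hQ₁pU k hkU))]
    · exact if_neg hkU
  have hRUan : MatAnalyticOn R U :=
    ((hQ₁p.inv hQ₁pU).mul hQ₂p).congr hUo fun k hk => (hRU k hk).symm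
  have hRLan : MatAnalyticOn R L :=
    (hQ₁m.mul (hQ₂m.inv hQ₂mU)).congr hLo fun k hk => (hRL k hk).symm
  refine ⟨R, fun i j k _ => (hcover k).elim (hRUan i j k) (hRLan i j k), hRU, hRL, ?_, ?_⟩
  · intro k hk
    rw [hRU k hk, Matrix.mul_nonsing_inv_cancel_left _ _ (detUnit (hQ₁pU k hk))]
  · intro k hk
    rw [hRL k hk, Matrix.nonsing_inv_mul_cancel_right _ _ (detUnit (hQ₂mU k hk))]
end
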